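/- Bilinear refinement of the Strichartz estimate (Bourgain). Let ε > 0 be sufficiently small. There is a constant C such that for every δ ∈ (0,1], all dyadic numbers N₁ ≤ N₂, and all Schwartz functions ψ₁, ψ₂ on ℝ² × ℝ whose spatial Fourier transforms ψ̂ᵢ(·,t) are supported in {ξ : N_i/2 ≤ |ξ| ≤ 2N_i} for every t, one has ‖ψ₁ ψ₂‖_{L²([0,δ] × ℝ²)} ≤ C (N₁/N₂)^{1/2} ‖ψ₁‖_{X^δ_{0,1/2+ε}} ‖ψ₂‖_{X^δ_{0,1/2+ε}}. The same estimate holds with ψ₁ψ₂ replaced by conj(ψ₁)·ψ₂ or ψ₁·conj(ψ₂). -/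

import Mathlib

open MeasureTheory Complex Set
open scoped FourierTransform BigOperators RealInnerProductSpace

noncomputable section

abbrev Rn (n : ℕ) := EuclideanSpace ℝ (Fin n)

/-- Japanese bracket of a vector. -/
def jap {n : ℕ} (ξ : Rn n) : ℝ := Real.sqrt (1 + ‖ξ‖ ^ 2)

/-- Japanese bracket of a real number. -/
def japR (x : ℝ) : ℝ := Real.sqrt (1 + x ^ 2)

/-- Inhomogeneous Sobolev norm ‖⟨ξ⟩^s f̂‖_{L²}. -/
def sobNorm (n : ℕ) (s : ℝ) (f : Rn n → ℂ) : ℝ :=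
  (∫ ξ : Rn n, jap ξ ^ (2 * s) * ‖𝓕 f ξ‖ ^ 2) ^ (1/2 : ℝ)

/-- Homogeneous Sobolev norm ‖|ξ|^s f̂‖_{L²}. -/
def sobNormHom (n : ℕ) (s : ℝ) (f : Rn n → ℂ) : ℝ :=
  (∫ ξ : Rn n, ‖ξ‖ ^ (2 * s) * ‖𝓕 f ξ‖ ^ 2) ^ (1/2 : ℝ)

/-- L^p norm on ℝⁿ. -/
def lpNorm (n : ℕ) (p : ℝ) (f : Rn n → ℂ) : ℝ :=
  (∫ x : Rn n, ‖f x‖ ^ p) ^ (1/p)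

/-- Laplacian: sum of second partial derivatives. -/
def laplacian {n : ℕ} (f : Rn n → ℂ) (x : Rn n) : ℂ :=
  ∑ i : Fin n, fderiv ℝ (fun y => fderiv ℝ f y (EuclideanSpace.single i 1)) x
    (EuclideanSpace.single i 1)

/-- Complex gradient as a vector in Euclidean space. -/
def gradC {n : ℕ} (f : Rn n → ℂ) (x : Rn n) : EuclideanSpace ℂ (Fin n) :=
  (WithLp.equiv 2 (Fin n → ℂ)).symm fun i => fderiv ℝ f x (EuclideanSpace.single i 1)

/-- φ is a solution of the cubic defocussing NLS on ℝⁿ × [0,T] with data φ₀: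
smooth, Schwartz in x uniformly for t ∈ [0,T] (with all derivatives),
satisfying i∂ₜφ + Δφ = |φ|²φ and φ(·,0) = φ₀. -/
def IsNLSSolution (n : ℕ) (T : ℝ) (φ : Rn n → ℝ → ℂ) (φ₀ : Rn n → ℂ) : Prop :=
  ContDiff ℝ (⊤ : ℕ∞) (fun p : Rn n × ℝ => φ p.1 p.2) ∧
  (∀ k l : ℕ, ∃ C : ℝ, ∀ t ∈ Icc (0:ℝ) T, ∀ x : Rn n,
      ‖x‖ ^ k * ‖iteratedFDeriv ℝ l (fun y => φ y t) x‖ ≤ C) ∧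
  (∀ x : Rn n, ∀ t ∈ Icc (0:ℝ) T,
      Complex.I * deriv (fun t' => φ x t') t + laplacian (fun y => φ y t) x
        = (‖φ x t‖ : ℂ) ^ 2 * φ x t) ∧
  (∀ x : Rn n, φ x 0 = φ₀ x)

/-- The energy E(f) = ∫ (1/2)|∇f|² + (1/4)|f|⁴. -/
def energy {n : ℕ} (f : Rn n → ℂ) : ℝ :=
  ∫ x : Rn n, ((1/2 : ℝ) * ∑ i : Fin n, ‖fderiv ℝ f x (EuclideanSpace.single i 1)‖ ^ 2
    + (1/4 : ℝ) * ‖f x‖ ^ 4)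

/-- m₁ is a smooth, radially symmetric, nonincreasing multiplier with
m₁ = 1 on the unit ball, m₁(ξ) = |ξ|^{-(1-s)} for |ξ| ≥ 2, 0 < m₁ ≤ 1. -/
def IsAdmissibleMultiplier (n : ℕ) (s : ℝ) (m₁ : Rn n → ℝ) : Prop :=
  ContDiff ℝ (⊤ : ℕ∞) m₁ ∧
  (∀ ξ : Rn n, 0 < m₁ ξ ∧ m₁ ξ ≤ 1) ∧
  (∀ ξ η : Rn n, ‖ξ‖ = ‖η‖ → m₁ ξ = m₁ η) ∧
  (∀ ξ η : Rn n, ‖ξ‖ ≤ ‖η‖ → m₁ η ≤ m₁ ξ) ∧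
  (∀ ξ : Rn n, ‖ξ‖ ≤ 1 → m₁ ξ = 1) ∧
  (∀ ξ : Rn n, 2 ≤ ‖ξ‖ → m₁ ξ = ‖ξ‖ ^ (-(1 - s)))

/-- The rescaled multiplier m_N(ξ) = m₁(ξ/N). -/
def mN {n : ℕ} (m₁ : Rn n → ℝ) (N : ℝ) (ξ : Rn n) : ℝ := m₁ (N⁻¹ • ξ)

/-- The smoothing operator I_N with Fourier multiplier m_N. -/
def Iop {n : ℕ} (m₁ : Rn n → ℝ) (N : ℝ) (f : Rn n → ℂ) : Rn n → ℂ :=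
  fun x => 𝓕⁻ (fun ξ => (mN m₁ N ξ : ℂ) * 𝓕 f ξ) x

/-- The spatial multiplier ⟨∇⟩^s. -/
def japMul (n : ℕ) (s : ℝ) (f : Rn n → ℂ) : Rn n → ℂ :=
  fun x => 𝓕⁻ (fun ξ => ((jap ξ ^ s : ℝ) : ℂ) * 𝓕 f ξ) x

/-- Sharp Littlewood–Paley projection onto {M ≤ ⟨ξ⟩ ≤ 2M}. -/
def LP (n : ℕ) (M : ℝ) (f : Rn n → ℂ) : Rn n → ℂ :=
  fun x => 𝓕⁻ (fun ξ => if M ≤ jap ξ ∧ jap ξ ≤ 2 * M then 𝓕 f ξ else 0) x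

/-- Space-time Fourier transform ψ̃(ξ,τ). -/
def stFourier (n : ℕ) {E : Type*} [NormedAddCommGroup E] [NormedSpace ℂ E]
    (ψ : Rn n → ℝ → E) (ξ : Rn n) (τ : ℝ) : E :=
  ∫ x : Rn n, ∫ t : ℝ,
    Complex.exp (Complex.I * ((-2 * Real.pi * (⟪x, ξ⟫ + t * τ) : ℝ) : ℂ)) • ψ x t

/-- The X_{s,b} norm ‖⟨ξ⟩^s ⟨τ-|ξ|²⟩^b ψ̃‖_{L²}. -/
def XNorm (n : ℕ) {E : Type*} [NormedAddCommGroup E] [NormedSpace ℂ E]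
    (s b : ℝ) (ψ : Rn n → ℝ → E) : ℝ :=
  (∫ ξ : Rn n, ∫ τ : ℝ,
    jap ξ ^ (2 * s) * japR (τ - ‖ξ‖ ^ 2) ^ (2 * b) * ‖stFourier n ψ ξ τ‖ ^ 2) ^ (1/2 : ℝ)

/-- The restricted norm X^δ_{s,b}: infimum over Schwartz extensions off ℝⁿ × [0,δ]. -/
def XRNorm (n : ℕ) {E : Type*} [NormedAddCommGroup E] [NormedSpace ℂ E]
    (s b δ : ℝ) (f : Rn n → ℝ → E) : ℝ :=
  sInf { r : ℝ | ∃ ψ : SchwartzMap (Rn n × ℝ) E,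
    (∀ x : Rn n, ∀ t ∈ Icc (0:ℝ) δ, ψ (x, t) = f x t) ∧
    r = XNorm n s b (fun x t => ψ (x, t)) }

/-- Space-time L^p norm on ℝⁿ × ℝ. -/
def lpNormST (n : ℕ) {E : Type*} [NormedAddCommGroup E] (p : ℝ) (F : Rn n → ℝ → E) : ℝ :=
  (∫ t : ℝ, ∫ x : Rn n, ‖F x t‖ ^ p) ^ (1/p)

/-- Space-time L^p norm on ℝⁿ × [0,δ]. -/
def lpNormSTt (n : ℕ) {E : Type*} [NormedAddCommGroup E] (p δ : ℝ) (F : Rn n → ℝ → E) : ℝ :=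
  (∫ t in Icc (0:ℝ) δ, ∫ x : Rn n, ‖F x t‖ ^ p) ^ (1/p)

/-- Plancherel's inequality for integrable functions. -/
lemma lintegral_enorm_sq_fourier_le {V : Type*} [NormedAddCommGroup V] [InnerProductSpace ℝ V]
    [FiniteDimensional ℝ V] [MeasurableSpace V] [BorelSpace V] {f : V → ℂ} (hf : Integrable f) :
    ∫⁻ v, ‖𝓕 f v‖ₑ ^ 2 ≤ ∫⁻ v, ‖f v‖ₑ ^ 2 := by
  by_cases htop : ∫⁻ v, ‖f v‖ₑ ^ 2 = ⊤
  · simp [htop]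
  have hnorm : ∀ g : V → ℂ, eLpNorm g 2 volume ^ 2 = ∫⁻ v, ‖g v‖ₑ ^ 2 := fun g => by
    have := eLpNorm_nnreal_pow_eq_lintegral (f := g) (μ := volume) (p := 2) (by norm_num)
    simpa using this
  have hf2 : MemLp f 2 volume := by
    refine ⟨hf.1, ?_⟩
    rw [lt_top_iff_ne_top]
    intro h
    apply htop
    rw [← hnorm, h]
    simp
  set F : Lp ℂ 2 (volume : Measure V) := 𝓕 (hf2.toLp f) with hF
  have hcont : Continuous (𝓕 f) :=
    VectorFourier.fourierIntegral_continuous (μ := volume) (L := innerₗ V)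
      Real.continuous_fourierChar (by exact continuous_inner) hf
  have hae : 𝓕 f =ᵐ[volume] F := by
    refine ae_eq_of_integral_contDiff_smul_eq hcont.locallyIntegrable
      ((Lp.memLp F).locallyIntegrable (by norm_num)) ?_
    intro g hg hgc
    have hgc' : HasCompactSupport (fun x => (g x : ℂ)) :=
      hgc.comp_left (g := fun y : ℝ => (y : ℂ)) (by simp)
    have hg' : ContDiff ℝ (⊤ : ℕ∞) (fun x => (g x : ℂ)) := Complex.ofRealCLM.contDiff.comp hg
    let G : SchwartzMap V ℂ := hgc'.toSchwartzMap hg'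
    have h1 := DFunLike.congr_fun (Lp.fourier_toTemperedDistribution_eq (hf2.toLp f)) G
    simp only [TemperedDistribution.fourier_apply] at h1
    rw [Lp.toTemperedDistribution_apply, Lp.toTemperedDistribution_apply] at h1
    have h2 : ∫ x, (𝓕 G) x • f x = ∫ x, G x • 𝓕 f x := by
      have := VectorFourier.integral_fourierIntegral_smul_eq_flip (f := G) (g := f)
        (L := innerₗ V) (μ := volume) (ν := volume)
        Real.continuous_fourierChar (by exact continuous_inner) G.integrable hf
      rw [flip_innerₗ] at this
      exact this
    have h3 : ∫ x, (𝓕 G) x • (hf2.toLp f) x = ∫ x, (𝓕 G) x • f x := by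
      apply integral_congr_ae
      filter_upwards [hf2.coeFn_toLp] with x hx
      rw [hx]
    have h4 : ∀ h : V → ℂ, ∫ x, g x • h x = ∫ x, G x • h x := fun h => by
      apply integral_congr_ae
      filter_upwards with x
      simp [G]
    rw [h4, h4, ← h2, ← h3, h1]
  rw [← hnorm, ← hnorm, eLpNorm_congr_ae hae, ← Lp.enorm_def, ← eLpNorm_congr_ae hf2.coeFn_toLp,
    ← Lp.enorm_def, ← ofReal_norm, ← ofReal_norm, hF, Lp.norm_fourier_eq]

/-- Cauchy–Schwarz in squared form. -/
lemma lintegral_mul_sq_le {α : Type*} [MeasurableSpace α] (μ : Measure α) {f g : α → ENNReal}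
    (hf : AEMeasurable f μ) (hg : AEMeasurable g μ) :
    (∫⁻ a, f a * g a ∂μ) ^ 2 ≤ (∫⁻ a, f a ^ 2 ∂μ) * ∫⁻ a, g a ^ 2 ∂μ := by
  have h := ENNReal.lintegral_mul_le_Lp_mul_Lq μ Real.HolderConjugate.two_two hf hg
  have h2 : ∀ x : ENNReal, (x ^ (1 / (2 : ℝ))) ^ 2 = x := fun x => by
    rw [← ENNReal.rpow_natCast, ← ENNReal.rpow_mul]; norm_num
  calc (∫⁻ a, f a * g a ∂μ) ^ 2 ≤ _ := pow_le_pow_left' h 2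
    _ = _ := by
      rw [mul_pow, h2, h2]
      simp only [ENNReal.rpow_two]

lemma lintegral_convolution_sq_le {V : Type*} [AddCommGroup V] [MeasurableSpace V]
    [MeasurableAdd₂ V] [MeasurableNeg V] (μ : Measure V) [SFinite μ] [μ.IsAddLeftInvariant]
    {G₁ G₂ B₁ B₂ : V → ENNReal} (hG₁ : Measurable G₁) (hG₂ : Measurable G₂)
    (hB₁ : Measurable B₁) (hB₂ : Measurable B₂) (K : ENNReal)
    (hK : ∀ q, ∫⁻ p, G₁ p ^ 2 * G₂ (q - p) ^ 2 ∂μ ≤ K) :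
    ∫⁻ q, (∫⁻ p, (G₁ p * B₁ p) * (G₂ (q - p) * B₂ (q - p)) ∂μ) ^ 2 ∂μ
      ≤ K * (∫⁻ p, B₁ p ^ 2 ∂μ) * ∫⁻ p, B₂ p ^ 2 ∂μ := by
  have hsub : Measurable fun z : V × V => z.1 - z.2 := by
    simp only [sub_eq_add_neg]; fun_prop
  have hsub' : ∀ q : V, Measurable fun z : V => q - z := fun q =>
    hsub.comp (measurable_const.prodMk measurable_id)
  have hstep : ∀ q, (∫⁻ p, (G₁ p * B₁ p) * (G₂ (q - p) * B₂ (q - p)) ∂μ) ^ 2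
      ≤ K * ∫⁻ p, B₁ p ^ 2 * B₂ (q - p) ^ 2 ∂μ := fun q => by
    have h := lintegral_mul_sq_le μ (f := fun p => G₁ p * G₂ (q - p))
      (g := fun p => B₁ p * B₂ (q - p))
      (hG₁.mul (hG₂.comp (hsub' q))).aemeasurable (hB₁.mul (hB₂.comp (hsub' q))).aemeasurable
    simp only [mul_pow] at h
    refine le_trans (le_of_eq ?_) (h.trans (mul_le_mul_left (hK q) _))
    congr 1
    apply lintegral_congr
    intro p
    ring
  calc _ ≤ ∫⁻ q, K * ∫⁻ p, B₁ p ^ 2 * B₂ (q - p) ^ 2 ∂μ ∂μ := lintegral_mono hstep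
    _ = K * ∫⁻ q, ∫⁻ p, B₁ p ^ 2 * B₂ (q - p) ^ 2 ∂μ ∂μ := by
      apply lintegral_const_mul
      apply Measurable.lintegral_prod_right'
        (f := fun z : V × V => B₁ z.2 ^ 2 * B₂ (z.1 - z.2) ^ 2)
      exact ((hB₁.comp measurable_snd).pow_const 2).mul ((hB₂.comp hsub).pow_const 2)
    _ = K * ∫⁻ p, ∫⁻ q, B₁ p ^ 2 * B₂ (q - p) ^ 2 ∂μ ∂μ := by
      rw [lintegral_lintegral_swap]
      exact (((hB₁.comp measurable_snd).pow_const 2).mul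
        ((hB₂.comp hsub).pow_const 2)).aemeasurable
    _ = K * ∫⁻ p, B₁ p ^ 2 * ∫⁻ q, B₂ q ^ 2 ∂μ ∂μ := by
      congr 1
      apply lintegral_congr
      intro p
      rw [lintegral_const_mul, lintegral_sub_right_eq_self (fun q => B₂ q ^ 2) p]
      exact (hB₂.comp (hsub.comp (measurable_id.prodMk measurable_const))).pow_const 2
    _ = _ := by
      rw [lintegral_mul_const _ (hB₁.pow_const 2), mul_assoc]

lemma volume_angles_le {r R : ℝ} (hr : 0 < r) (T : Set ℝ) (hT : T ⊆ Ioo (-Real.pi) Real.pi)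
    (h : ∀ θ ∈ T, ∀ θ' ∈ T,
      ‖Complex.polarCoord.symm (r, θ) - Complex.polarCoord.symm (r, θ')‖ ≤ 2 * R) :
    volume T ≤ ENNReal.ofReal (4 * Real.pi * (R / r)) := by
  rcases T.eq_empty_or_nonempty with rfl | ⟨θ₀, h₀⟩
  · simp
  have hpi := Real.pi_pos
  have hR : 0 ≤ R := by linarith [(norm_nonneg _).trans (h θ₀ h₀ θ₀ h₀)]
  set s := R / r with hs
  have hs0 : 0 ≤ s := by positivity
  have hpol : ∀ θ : ℝ, Complex.polarCoord.symm (r, θ) = r * Complex.exp (Complex.I * θ) :=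
    fun θ => by
      rw [Complex.polarCoord_symm_apply, mul_comm Complex.I, Complex.exp_mul_I]
      simp
  have hsin : ∀ θ ∈ T, |Real.sin ((θ - θ₀) / 2)| ≤ s := fun θ hθ => by
    have h1 := h θ hθ θ₀ h₀
    have h2 : (r : ℂ) * Complex.exp (Complex.I * θ) - r * Complex.exp (Complex.I * θ₀)
        = r * Complex.exp (Complex.I * θ₀) *
          (Complex.exp (Complex.I * ((θ - θ₀ : ℝ) : ℂ)) - 1) := by
      rw [mul_sub, mul_assoc, ← Complex.exp_add]
      push_cast
      ring_nf
    rw [hpol, hpol, h2, norm_mul, norm_mul, Complex.norm_exp_I_mul_ofReal_sub_one,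
      mul_comm Complex.I, Complex.norm_exp_ofReal_mul_I, norm_mul, Complex.norm_real,
      Real.norm_of_nonneg hr.le, Real.norm_eq_abs, Real.norm_eq_abs, abs_two] at h1
    rw [hs, le_div_iff₀ hr]
    linarith
  have key : ∀ α : ℝ, 0 ≤ α → α ≤ Real.pi → |Real.sin α| ≤ s →
      α ≤ Real.pi * s / 2 ∨ Real.pi - Real.pi * s / 2 ≤ α := fun α h0 h1 h2 => by
    have hle := (le_abs_self _).trans h2
    rcases le_total α (Real.pi / 2) with h3 | h3
    · left
      have := (Real.mul_le_sin h0 h3).trans hle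
      rw [div_mul_eq_mul_div, div_le_iff₀ hpi] at this
      linarith
    · right
      rw [← Real.sin_pi_sub] at hle
      have := (Real.mul_le_sin (by linarith) (by linarith : Real.pi - α ≤ Real.pi / 2)).trans hle
      rw [div_mul_eq_mul_div, div_le_iff₀ hpi] at this
      linarith
  have hsub : T ⊆ Icc (θ₀ - Real.pi * s) (θ₀ + Real.pi * s) ∪
      (Icc (θ₀ + 2 * Real.pi - Real.pi * s) (θ₀ + 2 * Real.pi) ∪
        Icc (θ₀ - 2 * Real.pi) (θ₀ - 2 * Real.pi + Real.pi * s)) := by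
    intro θ hθ
    have a1 := hT hθ
    have a2 := hT h₀
    simp only [mem_Ioo] at a1 a2
    have h3 := hsin θ hθ
    simp only [mem_union, mem_Icc]
    rcases le_total θ₀ θ with h4 | h4
    · rcases key ((θ - θ₀) / 2) (by linarith) (by linarith) h3 with h5 | h5
      · left; constructor <;> nlinarith
      · right; left; constructor <;> linarith
    · rcases key ((θ₀ - θ) / 2) (by linarith) (by linarith) (by
        rw [← abs_neg, ← Real.sin_neg]; convert h3 using 3; ring) with h5 | h5
      · left; constructor <;> nlinarith
      · right; right; constructor <;> linarith
  calc volume T ≤ _ := measure_mono hsub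
    _ ≤ _ := (measure_union_le _ _).trans (add_le_add_right (measure_union_le _ _) _)
    _ = _ := by
      rw [Real.volume_Icc, Real.volume_Icc, Real.volume_Icc, ← ENNReal.ofReal_add,
        ← ENNReal.ofReal_add]
      · congr 1; ring
      all_goals nlinarith

lemma lintegral_mul_comp_sub_sq_le (f : ℝ → ENNReal) (c : ℝ) :
    ∫⁻ r in Ioi (0 : ℝ), ENNReal.ofReal r * f (c - 2 * r ^ 2) ≤ ∫⁻ x, f x := by
  calc _ ≤ ∫⁻ r in Ioi (0 : ℝ), ENNReal.ofReal |-(4 * r)| * f (c - 2 * r ^ 2) := by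
        refine setLIntegral_mono' measurableSet_Ioi fun r hr => ?_
        have : (0 : ℝ) < r := hr
        gcongr
        rw [abs_neg, abs_of_pos (by positivity)]
        linarith
    _ = ∫⁻ x in (fun r : ℝ => c - 2 * r ^ 2) '' Ioi 0, f x := by
        rw [lintegral_image_eq_lintegral_abs_deriv_mul (f := fun r : ℝ => c - 2 * r ^ 2)
          (f' := fun r => -(4 * r)) measurableSet_Ioi]
        · intro x _
          convert! ((hasDerivAt_pow 2 x).const_mul 2).const_sub c |>.hasDerivWithinAt using 1
          simp only [Nat.cast_ofNat, Nat.add_one_sub_one, pow_one]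
          ring
        · intro x hx y hy hxy
          have hx' : (0 : ℝ) < x := hx
          have hy' : (0 : ℝ) < y := hy
          simp only [sub_right_inj, mul_eq_mul_left_iff, OfNat.ofNat_ne_zero, or_false] at hxy
          exact (pow_left_inj₀ hx'.le hy'.le two_ne_zero).1 hxy
    _ ≤ _ := setLIntegral_le_lintegral _ _

/-- Integrals over a planar set of a function of `‖η‖ ^ 2`, when every circle about the origin
meets the set in an arc of angular measure at most `A`. -/
lemma setLIntegral_comp_norm_sq_le {S : Set ℂ} (hS : MeasurableSet S) {f : ℝ → ENNReal}
    (hf : Measurable f) (c : ℝ) (A : ENNReal)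
    (hA : ∀ r : ℝ, 0 < r →
      volume {θ | θ ∈ Ioo (-Real.pi) Real.pi ∧ Complex.polarCoord.symm (r, θ) ∈ S} ≤ A) :
    ∫⁻ z in S, f (c - 2 * ‖z‖ ^ 2) ≤ A * ∫⁻ x, f x := by
  have hpc : Measurable fun p : ℝ × ℝ => Complex.polarCoord.symm p := by
    simp only [Complex.polarCoord_symm_apply]; fun_prop
  rw [← lintegral_indicator hS, ← Complex.lintegral_comp_polarCoord_symm, polarCoord_target]
  simp only [smul_eq_mul]
  rw [Measure.volume_eq_prod, ← Measure.prod_restrict, lintegral_prod]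
  · calc _ ≤ ∫⁻ r in Ioi (0 : ℝ), A * (ENNReal.ofReal r * f (c - 2 * r ^ 2)) := by
          refine setLIntegral_mono' measurableSet_Ioi fun r hr => ?_
          have hm : MeasurableSet {θ : ℝ | Complex.polarCoord.symm (r, θ) ∈ S} :=
            (hpc.comp (measurable_const.prodMk measurable_id)) hS
          have h1 : ∀ θ : ℝ, ENNReal.ofReal r * S.indicator (fun z => f (c - 2 * ‖z‖ ^ 2))
              (Complex.polarCoord.symm (r, θ))
              = {θ : ℝ | Complex.polarCoord.symm (r, θ) ∈ S}.indicator
                (fun _ => ENNReal.ofReal r * f (c - 2 * r ^ 2)) θ := fun θ => by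
            by_cases h : Complex.polarCoord.symm (r, θ) ∈ S
            · rw [indicator_of_mem h, indicator_of_mem (by exact h), Complex.norm_polarCoord_symm,
                sq_abs]
            · rw [indicator_of_notMem h, indicator_of_notMem (by exact h), mul_zero]
          simp only [h1]
          rw [lintegral_indicator hm, setLIntegral_const, mul_comm,
            Measure.restrict_apply hm]
          gcongr
          refine le_trans (le_of_eq ?_) (hA r hr)
          congr 1
          ext θ
          simp [and_comm]
      _ = A * ∫⁻ r in Ioi (0 : ℝ), ENNReal.ofReal r * f (c - 2 * r ^ 2) := by
          rw [lintegral_const_mul]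
          fun_prop
      _ ≤ _ := mul_le_mul_right (lintegral_mul_comp_sub_sq_le f c) A
  · refine Measurable.aemeasurable ?_
    refine Measurable.mul (by fun_prop) ?_
    exact ((hf.comp (by fun_prop)).indicator hS).comp hpc

/-- The frequency annulus of scale `N`. -/
def annulus (N : ℝ) : Set (Rn 2) := {ξ | N / 2 ≤ ‖ξ‖ ∧ ‖ξ‖ ≤ 2 * N}

lemma measurableSet_annulus (N : ℝ) : MeasurableSet (annulus N) :=
  (measurableSet_le measurable_const measurable_norm).inter
    (measurableSet_le measurable_norm measurable_const)

lemma volume_interaction_angles_le {N₁ N₂ : ℝ} (h₁ : 0 < N₁) (h₂ : 0 < N₂) (e : ℂ ≃ₗᵢ[ℝ] Rn 2)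
    (ξ : Rn 2) {r : ℝ} (hr : 0 < r) :
    volume {θ | θ ∈ Ioo (-Real.pi) Real.pi ∧ Complex.polarCoord.symm (r, θ) ∈
      {z : ℂ | e z + (2 : ℝ)⁻¹ • ξ ∈ annulus N₁ ∧ (2 : ℝ)⁻¹ • ξ - e z ∈ annulus N₂}}
      ≤ ENNReal.ofReal (64 * Real.pi * (N₁ / N₂)) := by
  have hpi := Real.pi_pos
  set T := {θ | θ ∈ Ioo (-Real.pi) Real.pi ∧ Complex.polarCoord.symm (r, θ) ∈
      {z : ℂ | e z + (2 : ℝ)⁻¹ • ξ ∈ annulus N₁ ∧ (2 : ℝ)⁻¹ • ξ - e z ∈ annulus N₂}} with hT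
  rcases le_or_gt N₂ (8 * N₁) with hN | hN
  · calc volume T ≤ volume (Ioo (-Real.pi) Real.pi) := measure_mono fun θ hθ => hθ.1
      _ ≤ _ := by
        rw [Real.volume_Ioo]
        apply ENNReal.ofReal_le_ofReal
        have : 1 / 8 ≤ N₁ / N₂ := by rw [le_div_iff₀ h₂]; linarith
        nlinarith
  · rcases T.eq_empty_or_nonempty with h | ⟨θ₀, h₀⟩
    · simp [h]
    have hrN : N₂ / 8 ≤ r := by
      obtain ⟨-, ha, hb⟩ := h₀
      have hn : ‖Complex.polarCoord.symm (r, θ₀)‖ = r := by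
        rw [Complex.norm_polarCoord_symm, abs_of_pos hr]
      set z := Complex.polarCoord.symm (r, θ₀)
      have h3 : (2 : ℝ)⁻¹ • ξ - e z = (e z + (2 : ℝ)⁻¹ • ξ) - (2 : ℝ) • e z := by
        rw [two_smul]; abel
      have h4 : ‖(2 : ℝ)⁻¹ • ξ - e z‖ ≤ 2 * N₁ + 2 * r := by
        rw [h3]
        refine (norm_sub_le _ _).trans (add_le_add ha.2 ?_)
        rw [norm_smul, e.norm_map, hn]
        simp
      have := hb.1
      linarith
    refine (volume_angles_le (R := 2 * N₁) hr T (fun θ hθ => hθ.1) ?_).trans ?_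
    · intro θ hθ θ' hθ'
      rw [← e.norm_map, map_sub, ← add_sub_add_right_eq_sub _ _ ((2 : ℝ)⁻¹ • ξ)]
      refine (norm_sub_le _ _).trans ?_
      have := hθ.2.1.2
      have := hθ'.2.1.2
      linarith
    · apply ENNReal.ofReal_le_ofReal
      have : 2 * N₁ / r ≤ 16 * (N₁ / N₂) := by
        rw [← mul_div_assoc, div_le_div_iff₀ hr h₂]
        nlinarith
      nlinarith

/-- The convolution of two neighbourhoods of the paraboloid over annuli of scales `N₁` and `N₂`. -/
lemma lintegral_kernel_le {N₁ N₂ : ℝ} (h₁ : 0 < N₁) (h₂ : 0 < N₂) {h : ℝ → ENNReal}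
    (hh : Measurable h) (ξ : Rn 2) (τ : ℝ) :
    ∫⁻ p : Rn 2 × ℝ, (annulus N₁).indicator (fun _ => h (p.2 - ‖p.1‖ ^ 2)) p.1 *
      (annulus N₂).indicator (fun _ => h (τ - p.2 - ‖ξ - p.1‖ ^ 2)) (ξ - p.1)
      ≤ ENNReal.ofReal (64 * Real.pi * (N₁ / N₂)) * (∫⁻ y, h y) ^ 2 := by
  have hG : Measurable fun y : ℝ => ∫⁻ s, h s * h (y - s) := by
    apply Measurable.lintegral_prod_right' (f := fun z : ℝ × ℝ => h z.2 * h (z.1 - z.2))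
    fun_prop
  set G : ℝ → ENNReal := fun y => ∫⁻ s, h s * h (y - s) with hGdef
  have hGint : ∫⁻ y, G y = (∫⁻ y, h y) ^ 2 := by
    rw [hGdef, lintegral_lintegral_swap]
    · calc _ = ∫⁻ s, h s * ∫⁻ y, h y := by
            apply lintegral_congr
            intro s
            rw [lintegral_const_mul _ (by fun_prop), lintegral_sub_right_eq_self h s]
        _ = _ := by rw [lintegral_mul_const _ hh, sq]
    · exact Measurable.aemeasurable (by fun_prop)
  set S : Set (Rn 2) := {ξ₁ | ξ₁ ∈ annulus N₁ ∧ ξ - ξ₁ ∈ annulus N₂} with hS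
  have hSm : MeasurableSet S := (measurableSet_annulus N₁).inter
    (measurableSet_preimage (f := fun ξ₁ : Rn 2 => ξ - ξ₁)
      (measurable_const.sub measurable_id) (measurableSet_annulus N₂))
  have hm1 : Measurable fun p : Rn 2 × ℝ =>
      (annulus N₁).indicator (fun _ => h (p.2 - ‖p.1‖ ^ 2)) p.1 := by
    have : Measurable fun p : Rn 2 × ℝ => h (p.2 - ‖p.1‖ ^ 2) := by fun_prop
    classical
    simp only [indicator_apply]
    exact this.ite (measurableSet_preimage measurable_fst (measurableSet_annulus N₁))
      measurable_const
  have hm2 : Measurable fun p : Rn 2 × ℝ =>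
      (annulus N₂).indicator (fun _ => h (τ - p.2 - ‖ξ - p.1‖ ^ 2)) (ξ - p.1) := by
    have : Measurable fun p : Rn 2 × ℝ => h (τ - p.2 - ‖ξ - p.1‖ ^ 2) := by fun_prop
    classical
    simp only [indicator_apply]
    exact this.ite (measurableSet_preimage (f := fun p : Rn 2 × ℝ => ξ - p.1)
      (measurable_const.sub measurable_fst) (measurableSet_annulus N₂)) measurable_const
  obtain ⟨e⟩ : Nonempty (ℂ ≃ₗᵢ[ℝ] Rn 2) := ⟨Complex.orthonormalBasisOneI.repr⟩
  rw [Measure.volume_eq_prod, lintegral_prod]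
  swap
  · exact (hm1.mul hm2).aemeasurable
  calc _ = ∫⁻ ξ₁, S.indicator (fun ξ₁ => G (τ - ‖ξ₁‖ ^ 2 - ‖ξ - ξ₁‖ ^ 2)) ξ₁ := by
        apply lintegral_congr
        intro ξ₁
        by_cases ha : ξ₁ ∈ annulus N₁
        · by_cases hb : ξ - ξ₁ ∈ annulus N₂
          · rw [indicator_of_mem (show ξ₁ ∈ S from ⟨ha, hb⟩)]
            simp only [indicator_of_mem ha, indicator_of_mem hb]
            rw [hGdef]
            simp only
            rw [← lintegral_add_right_eq_self _ (‖ξ₁‖ ^ 2)]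
            apply lintegral_congr
            intro s
            congr 2 <;> ring
          · rw [indicator_of_notMem (fun h : ξ₁ ∈ S => hb h.2)]
            simp only [indicator_of_notMem hb, mul_zero, lintegral_zero]
        · rw [indicator_of_notMem (fun h : ξ₁ ∈ S => ha h.1)]
          simp only [indicator_of_notMem ha, zero_mul, lintegral_zero]
    _ = ∫⁻ z : ℂ, S.indicator (fun ξ₁ => G (τ - ‖ξ₁‖ ^ 2 - ‖ξ - ξ₁‖ ^ 2))
          (e z + (2 : ℝ)⁻¹ • ξ) := by
        rw [← lintegral_add_right_eq_self _ ((2 : ℝ)⁻¹ • ξ),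
          ← e.measurePreserving.lintegral_comp_emb e.toMeasurableEquiv.measurableEmbedding]
    _ = ∫⁻ z in {z : ℂ | e z + (2 : ℝ)⁻¹ • ξ ∈ annulus N₁ ∧ (2 : ℝ)⁻¹ • ξ - e z ∈ annulus N₂},
          G ((τ - ‖ξ‖ ^ 2 / 2) - 2 * ‖z‖ ^ 2) := by
        have hmem : ∀ z : ℂ, (e z + (2 : ℝ)⁻¹ • ξ ∈ S ↔
            e z + (2 : ℝ)⁻¹ • ξ ∈ annulus N₁ ∧ (2 : ℝ)⁻¹ • ξ - e z ∈ annulus N₂) := fun z => by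
          have : ξ - (e z + (2 : ℝ)⁻¹ • ξ) = (2 : ℝ)⁻¹ • ξ - e z := by module
          simp only [hS, mem_ofPred_eq, this]
        rw [← lintegral_indicator]
        · apply lintegral_congr
          intro z
          by_cases hz : e z + (2 : ℝ)⁻¹ • ξ ∈ S
          · rw [indicator_of_mem hz, indicator_of_mem (by exact (hmem z).1 hz)]
            have h3 : ξ - (e z + (2 : ℝ)⁻¹ • ξ) = (2 : ℝ)⁻¹ • ξ - e z := by module
            have h4 := parallelogram_law_with_norm ℝ ((2 : ℝ)⁻¹ • ξ) (e z)
            rw [norm_smul, e.norm_map] at h4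
            rw [h3, add_comm (e z)]
            congr 1
            norm_num at h4
            linarith
          · rw [indicator_of_notMem hz, indicator_of_notMem]
            exact fun h => hz ((hmem z).2 h)
        · simp only [← hmem]
          exact measurableSet_preimage (f := fun z => e z + (2 : ℝ)⁻¹ • ξ)
            (e.continuous.measurable.add_const _) hSm
    _ ≤ _ := by
        rw [← hGint]
        apply setLIntegral_comp_norm_sq_le _ hG
        · intro r hr
          exact volume_interaction_angles_le h₁ h₂ e ξ hr
        · exact (measurableSet_preimage (f := fun z => e z + (2 : ℝ)⁻¹ • ξ)
            (e.continuous.measurable.add_const _) (measurableSet_annulus N₁)).inter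
            (measurableSet_preimage (f := fun z => (2 : ℝ)⁻¹ • ξ - e z)
              (measurable_const.sub e.continuous.measurable) (measurableSet_annulus N₂))

lemma japR_pos (y : ℝ) : 0 < japR y := Real.sqrt_pos.2 (by positivity)

lemma continuous_japR : Continuous japR := by
  unfold japR; fun_prop

lemma japR_rpow (y s : ℝ) : japR y ^ s = (1 + y ^ 2) ^ (s / 2) := by
  rw [japR, Real.sqrt_eq_rpow, ← Real.rpow_mul (by positivity)]
  ring_nf

lemma lintegral_japR_rpow_lt_top {b : ℝ} (hb : 1 / 2 < b) :
    ∫⁻ y, ENNReal.ofReal (japR y ^ (-(2 * b))) < ⊤ := by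
  have h := integrable_rpow_neg_one_add_norm_sq (E := ℝ) (μ := volume) (r := 2 * b)
    (by rw [Module.finrank_self]; push_cast; linarith)
  simp only [Real.norm_eq_abs, sq_abs] at h
  simp only [japR_rpow]
  exact h.lintegral_lt_top

/-- Space-time with its Euclidean structure. -/
abbrev SpaceTime := WithLp 2 (Rn 2 × ℝ)

/-- The modulation weight, the distance to the paraboloid. -/
def modulation (v : SpaceTime) : ℝ := japR (v.snd - ‖v.fst‖ ^ 2)

lemma continuous_modulation : Continuous modulation := by
  unfold modulation
  exact continuous_japR.comp (by fun_prop)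

lemma modulation_pos (v : SpaceTime) : 0 < modulation v := japR_pos _

/-- Bilinear estimate on the Fourier side. -/
lemma lintegral_enorm_sq_fourier_mul_le {b N₁ N₂ : ℝ} (h₁ : 0 < N₁) (h₂ : 0 < N₂)
    {a₁ a₂ : SpaceTime → ℂ} (ha₁ : Integrable a₁) (ha₂ : Integrable a₂)
    (hm₁ : Measurable a₁) (hm₂ : Measurable a₂)
    (hs₁ : ∀ v, v.fst ∉ annulus N₁ → a₁ v = 0) (hs₂ : ∀ v, v.fst ∉ annulus N₂ → a₂ v = 0) :
    ∫⁻ v, ‖𝓕 a₁ v * 𝓕 a₂ v‖ₑ ^ 2 ≤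
      ENNReal.ofReal (64 * Real.pi * (N₁ / N₂)) *
        (∫⁻ y, ENNReal.ofReal (japR y ^ (-(2 * b)))) ^ 2 *
        (∫⁻ v, ENNReal.ofReal (modulation v ^ (2 * b)) * ‖a₁ v‖ₑ ^ 2) *
        ∫⁻ v, ENNReal.ofReal (modulation v ^ (2 * b)) * ‖a₂ v‖ₑ ^ 2 := by
  classical
  let G : ℝ → SpaceTime → ENNReal := fun N v =>
    if v.fst ∈ annulus N then ENNReal.ofReal (modulation v ^ (-b)) else 0
  let B : (SpaceTime → ℂ) → SpaceTime → ENNReal := fun a v =>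
    ENNReal.ofReal (modulation v ^ b) * ‖a v‖ₑ
  have hfst : Measurable fun v : SpaceTime => v.fst :=
    Continuous.measurable (by fun_prop)
  have hmod : ∀ s : ℝ, Measurable fun v => ENNReal.ofReal (modulation v ^ s) := fun s =>
    (continuous_modulation.measurable.pow_const s).ennreal_ofReal
  have hG : ∀ N, Measurable (G N) := fun N =>
    (hmod _).ite (measurableSet_preimage hfst (measurableSet_annulus N)) measurable_const
  have hB : ∀ {a : SpaceTime → ℂ}, Measurable a → Measurable (B a) := fun ha =>
    (hmod b).mul ha.enorm
  have hBsq : ∀ a v, B a v ^ 2 = ENNReal.ofReal (modulation v ^ (2 * b)) * ‖a v‖ₑ ^ 2 :=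
    fun a v => by
      simp only [B]
      rw [mul_pow, ← ENNReal.ofReal_pow (by have := modulation_pos v; positivity),
        ← Real.rpow_mul_natCast (modulation_pos v).le, mul_comm b]
      norm_num
  have hGB : ∀ (N : ℝ) (a : SpaceTime → ℂ), (∀ v, v.fst ∉ annulus N → a v = 0) →
      ∀ v, ‖a v‖ₑ = G N v * B a v := fun N a ha v => by
    by_cases hv : v.fst ∈ annulus N
    · simp only [G, B, if_pos hv]
      rw [← mul_assoc, ← ENNReal.ofReal_mul (by have := modulation_pos v; positivity),
        ← Real.rpow_add (modulation_pos v)]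
      simp
    · simp [B, ha v hv]
  have hK : ∀ q, ∫⁻ p, G N₁ p ^ 2 * G N₂ (q - p) ^ 2 ≤
      ENNReal.ofReal (64 * Real.pi * (N₁ / N₂)) *
        (∫⁻ y, ENNReal.ofReal (japR y ^ (-(2 * b)))) ^ 2 := fun q => by
    have h3 := lintegral_kernel_le h₁ h₂ (h := fun y => ENNReal.ofReal (japR y ^ (-(2 * b))))
      (continuous_japR.measurable.pow_const _).ennreal_ofReal q.fst q.snd
    refine le_trans (le_of_eq ?_) h3
    rw [← (WithLp.volume_preserving_toLp (Rn 2) ℝ).lintegral_comp_emb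
      (MeasurableEquiv.toLp 2 (Rn 2 × ℝ)).measurableEmbedding]
    have hsq : ∀ y : ℝ, ENNReal.ofReal (japR y ^ (-b)) ^ 2
        = ENNReal.ofReal (japR y ^ (-(2 * b))) := fun y => by
      rw [← ENNReal.ofReal_pow (by have := japR_pos y; positivity),
        ← Real.rpow_mul_natCast (japR_pos y).le]
      congr 2
      push_cast
      ring
    apply lintegral_congr
    intro p
    congr 1
    · by_cases hp : p.1 ∈ annulus N₁
      · simp [G, hp, modulation, hsq]
      · simp [G, hp]
    · by_cases hp : q.fst - p.1 ∈ annulus N₂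
      · simp [G, hp, modulation, hsq]
      · simp [G, hp]
  calc _ = ∫⁻ v, ‖𝓕 (MeasureTheory.convolution a₁ a₂ (ContinuousLinearMap.mul ℂ ℂ) volume) v‖ₑ ^ 2 := by
        simp only [Real.fourier_mul_convolution_eq ha₁ ha₂]
    _ ≤ ∫⁻ q, ‖MeasureTheory.convolution a₁ a₂ (ContinuousLinearMap.mul ℂ ℂ) volume q‖ₑ ^ 2 :=
        lintegral_enorm_sq_fourier_le
          (ha₁.integrable_convolution (ContinuousLinearMap.mul ℂ ℂ) ha₂)
    _ ≤ ∫⁻ q, (∫⁻ p, (G N₁ p * B a₁ p) * (G N₂ (q - p) * B a₂ (q - p))) ^ 2 := by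
        refine lintegral_mono fun q => pow_le_pow_left' ?_ 2
        refine (enorm_integral_le_lintegral_enorm _).trans (lintegral_mono fun p => ?_)
        simp only [← hGB N₁ a₁ hs₁, ← hGB N₂ a₂ hs₂, ContinuousLinearMap.mul_apply', enorm_mul,
          le_refl]
    _ ≤ _ := by
        simp only [← hBsq]
        exact lintegral_convolution_sq_le volume (hG N₁) (hG N₂) (hB hm₁) (hB hm₂) _ hK


lemma integrable_comp_toLp {E : Type*} [NormedAddCommGroup E]
    {f : SpaceTime → E} (hf : Integrable f) :
    Integrable fun p : Rn 2 × ℝ => f (WithLp.toLp 2 p) :=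
  ((WithLp.volume_preserving_toLp (Rn 2) ℝ).integrable_comp_emb
    (MeasurableEquiv.toLp 2 (Rn 2 × ℝ)).measurableEmbedding).2 hf

/-- Integration over space-time as an iterated integral. -/
lemma integral_spaceTime {E : Type*} [NormedAddCommGroup E] [NormedSpace ℝ E]
    {f : SpaceTime → E} (hf : Integrable f) :
    ∫ v, f v = ∫ ξ : Rn 2, ∫ τ : ℝ, f (WithLp.toLp 2 (ξ, τ)) := by
  rw [← (WithLp.volume_preserving_toLp (Rn 2) ℝ).integral_comp
    (MeasurableEquiv.toLp 2 (Rn 2 × ℝ)).measurableEmbedding f]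
  exact integral_prod (fun p => f (WithLp.toLp 2 p)) (integrable_comp_toLp hf)

lemma inner_spaceTime (x ξ : Rn 2) (t τ : ℝ) :
    (⟪(WithLp.toLp 2 (x, t) : SpaceTime), WithLp.toLp 2 (ξ, τ)⟫ : ℝ) = ⟪x, ξ⟫ + t * τ := by
  rw [WithLp.prod_inner_apply]
  simp [mul_comm]

lemma integrable_fourierChar_smul {V : Type*} [NormedAddCommGroup V] [InnerProductSpace ℝ V]
    [MeasurableSpace V] [BorelSpace V] [SecondCountableTopology V] {μ : Measure V} {a : V → ℂ}
    (ha : Integrable a μ) (w : V) :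
    Integrable (fun v => Real.fourierChar ⟪v, w⟫ • a v) μ := by
  simpa using (VectorFourier.fourierIntegral_convergent_iff (L := innerₗ V)
    Real.continuous_fourierChar (by exact continuous_inner) (-w)).2 ha

lemma measurableSet_fst_mem_annulus {N : ℝ} :
    MeasurableSet {v : SpaceTime | v.fst ∈ annulus N} :=
  measurableSet_preimage (f := fun v : SpaceTime => v.fst)
    (Continuous.measurable (by fun_prop)) (measurableSet_annulus N)

/-- The inverse Fourier transform in the time variable only. -/
def timeFourierInv (a : SpaceTime → ℂ) (t : ℝ) (ξ : Rn 2) : ℂ :=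
  ∫ τ : ℝ, Real.fourierChar (τ * t) • a (WithLp.toLp 2 (ξ, τ))

lemma fourierInv_toLp {a : SpaceTime → ℂ} (ha : Integrable a) (x : Rn 2) (t : ℝ) :
    𝓕⁻ a (WithLp.toLp 2 (x, t)) = 𝓕⁻ (timeFourierInv a t) x := by
  rw [Real.fourierInv_eq, Real.fourierInv_eq,
    integral_spaceTime (integrable_fourierChar_smul ha _)]
  simp_rw [timeFourierInv, inner_spaceTime, AddChar.map_add_eq_mul, mul_smul, Circle.smul_def,
    integral_smul]

lemma integrable_timeFourierInv {a : SpaceTime → ℂ} (ha : Integrable a) (t : ℝ) :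
    Integrable (timeFourierInv a t) := by
  have h := (integrable_comp_toLp
    (integrable_fourierChar_smul ha (WithLp.toLp 2 (0, t)))).integral_prod_left
  simpa only [inner_spaceTime, inner_zero_right, zero_add] using! h

lemma exists_norm_le_rpow_one_add_norm (F : SchwartzMap SpaceTime ℂ) :
    ∃ C : ℝ, 0 ≤ C ∧ ∀ v, ‖F v‖ ≤ C * (1 + ‖v‖) ^ (-(4 : ℝ)) := by
  refine ⟨2 ^ 4 * (Finset.Iic (4, 0)).sup (fun m => SchwartzMap.seminorm ℝ m.1 m.2) F,
    by positivity, fun v => ?_⟩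
  have h := F.one_add_le_sup_seminorm_apply (𝕜 := ℝ) (m := (4, 0)) le_rfl le_rfl v
  have hp : 0 < (1 + ‖v‖) ^ 4 := by positivity
  rw [norm_iteratedFDeriv_zero, mul_comm, ← le_div_iff₀ hp] at h
  rwa [Real.rpow_neg (by positivity), ← div_eq_mul_inv, show (4 : ℝ) = (4 : ℕ) by norm_num,
    Real.rpow_natCast]

lemma continuous_timeFourierInv (F : SchwartzMap SpaceTime ℂ) (t : ℝ) :
    Continuous (timeFourierInv F t) := by
  obtain ⟨C, hC, hF⟩ := exists_norm_le_rpow_one_add_norm F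
  refine continuous_of_dominated (bound := fun τ => C * (1 + ‖τ‖) ^ (-(4 : ℝ)))
    (fun ξ => ?_) (fun ξ => ?_) ?_ ?_
  · have h : Continuous fun τ : ℝ => Real.fourierChar (τ * t) :=
      Real.continuous_fourierChar.comp (by fun_prop)
    exact (h.smul (F.continuous.comp (by fun_prop))).aestronglyMeasurable
  · refine Filter.Eventually.of_forall fun τ => ?_
    rw [Circle.norm_smul]
    refine (hF _).trans ?_
    have : ‖τ‖ ≤ _ := WithLp.norm_snd_le (Rn 2) (WithLp.toLp 2 (ξ, τ))
    gcongr C * ?_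
    exact Real.rpow_le_rpow_of_nonpos (by positivity) (by gcongr) (by norm_num)
  · refine (integrable_one_add_norm ?_).const_mul C
    rw [Module.finrank_self]; norm_num
  · refine Filter.Eventually.of_forall fun τ => Continuous.smul continuous_const ?_
    exact F.continuous.comp (by fun_prop)

lemma integrable_slice (F : SchwartzMap SpaceTime ℂ) (t : ℝ) :
    Integrable fun x : Rn 2 => F (WithLp.toLp 2 (x, t)) := by
  obtain ⟨C, hC, hF⟩ := exists_norm_le_rpow_one_add_norm F
  have hi : Integrable fun x : Rn 2 => C * (1 + ‖x‖) ^ (-(4 : ℝ)) := by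
    refine (integrable_one_add_norm ?_).const_mul C
    rw [finrank_euclideanSpace_fin]; norm_num
  refine hi.mono' (F.continuous.comp (by fun_prop)).aestronglyMeasurable
    (Filter.Eventually.of_forall fun x => (hF _).trans ?_)
  have : ‖x‖ ≤ _ := WithLp.norm_fst_le (Rn 2) (WithLp.toLp 2 (x, t))
  gcongr C * ?_
  exact Real.rpow_le_rpow_of_nonpos (by positivity) (by gcongr) (by norm_num)

/-- The spatial Fourier transform of a time slice of a Schwartz function. -/
lemma fourier_slice (F : SchwartzMap SpaceTime ℂ) (t : ℝ) :
    𝓕 (fun x => 𝓕⁻ (F : SpaceTime → ℂ) (WithLp.toLp 2 (x, t))) = timeFourierInv F t := by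
  have hinv : (fun x => 𝓕⁻ (F : SpaceTime → ℂ) (WithLp.toLp 2 (x, t))) =
      𝓕⁻ (timeFourierInv F t) := by
    ext x
    rw [fourierInv_toLp F.integrable]
  have hi := integrable_slice (𝓕⁻ F) t
  rw [SchwartzMap.fourierInv_coe, hinv] at hi
  rw [hinv]
  refine (continuous_timeFourierInv F t).fourier_fourierInv_eq
    (integrable_timeFourierInv F.integrable t) (hi.comp_neg.congr (.of_forall fun x => ?_))
  simp [Real.fourierInv_eq_fourier_neg]

/-- A slice with spatial frequencies in an annulus only sees those frequencies. -/
lemma fourierInv_eq_fourierInv_indicator (F : SchwartzMap SpaceTime ℂ) {N t : ℝ}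
    (hs : Function.support (𝓕 fun x => 𝓕⁻ (F : SpaceTime → ℂ) (WithLp.toLp 2 (x, t))) ⊆
      annulus N) (x : Rn 2) :
    𝓕⁻ (F : SpaceTime → ℂ) (WithLp.toLp 2 (x, t)) =
      𝓕⁻ ({v | v.fst ∈ annulus N}.indicator F) (WithLp.toLp 2 (x, t)) := by
  have h : timeFourierInv ({v | v.fst ∈ annulus N}.indicator F) t = timeFourierInv F t := by
    ext ξ
    by_cases hξ : ξ ∈ annulus N
    · simp [timeFourierInv, indicator, hξ]
    · rw [← fourier_slice, Function.notMem_support.1 fun h => hξ (hs h)]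
      simp [timeFourierInv, indicator, hξ]
  rw [fourierInv_toLp (F.integrable.indicator measurableSet_fst_mem_annulus), h,
    ← fourierInv_toLp F.integrable]

/-- A Schwartz function on `ℝ² × ℝ`, seen on Euclidean space-time. -/
def toSpaceTime (Ψ : SchwartzMap (Rn 2 × ℝ) ℂ) : SchwartzMap SpaceTime ℂ :=
  SchwartzMap.compCLMOfContinuousLinearEquiv ℂ (WithLp.prodContinuousLinearEquiv 2 ℝ (Rn 2) ℝ) Ψ

lemma toSpaceTime_toLp (Ψ : SchwartzMap (Rn 2 × ℝ) ℂ) (p : Rn 2 × ℝ) :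
    toSpaceTime Ψ (WithLp.toLp 2 p) = Ψ p := rfl

lemma stFourier_eq_fourier (Ψ : SchwartzMap (Rn 2 × ℝ) ℂ) (ξ : Rn 2) (τ : ℝ) :
    stFourier 2 (fun x t => Ψ (x, t)) ξ τ = 𝓕 (toSpaceTime Ψ) (WithLp.toLp 2 (ξ, τ)) := by
  have hi := integrable_fourierChar_smul (toSpaceTime Ψ).integrable (-WithLp.toLp 2 (ξ, τ))
    (μ := volume)
  simp only [inner_neg_right] at hi
  rw [SchwartzMap.fourier_coe, Real.fourier_eq, integral_spaceTime hi, stFourier]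
  congr 1 with x
  congr 1 with t
  rw [inner_spaceTime, Circle.smul_def, Real.fourierChar_apply, toSpaceTime_toLp]
  congr 2
  push_cast
  ring

lemma modulation_rpow_le {b : ℝ} (hb : b ≤ 1) (v : SpaceTime) :
    modulation v ^ (2 * b) ≤ 1 + 2 * ‖v‖ ^ 2 + 2 * ‖v‖ ^ 4 := by
  have h := WithLp.prod_norm_sq_eq_of_L2 v
  rw [modulation, japR_rpow, mul_div_cancel_left₀ b two_ne_zero]
  refine (Real.rpow_le_rpow_of_exponent_le (le_add_of_nonneg_right (sq_nonneg _)) hb).trans ?_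
  rw [Real.rpow_one]
  rw [Real.norm_eq_abs, sq_abs] at h
  nlinarith [sq_nonneg (v.snd + ‖v.fst‖ ^ 2), sq_nonneg v.snd, sq_nonneg ‖v.fst‖,
    mul_nonneg (sq_nonneg v.snd) (sq_nonneg ‖v.fst‖), sq_nonneg (v.snd ^ 2)]

lemma integrable_modulation_mul {b : ℝ} (hb : b ≤ 1) (F : SchwartzMap SpaceTime ℂ) :
    Integrable fun v => modulation v ^ (2 * b) * ‖F v‖ ^ 2 := by
  obtain ⟨C, hC, hF⟩ := exists_norm_le_rpow_one_add_norm F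
  have hF' : ∀ v, ‖F v‖ ≤ C := fun v => (hF v).trans <|
    mul_le_of_le_one_right hC
      (Real.rpow_le_one_of_one_le_of_nonpos (le_add_of_nonneg_right (norm_nonneg v)) (by norm_num))
  have hi : Integrable fun v =>
      C * (‖v‖ ^ 0 * ‖F v‖ + 2 * (‖v‖ ^ 2 * ‖F v‖) + 2 * (‖v‖ ^ 4 * ‖F v‖)) :=
    (((F.integrable_pow_mul volume 0).add ((F.integrable_pow_mul volume 2).const_mul 2)).add
      ((F.integrable_pow_mul volume 4).const_mul 2)).const_mul C
  refine hi.mono' ?_ (.of_forall fun v => ?_)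
  · exact ((continuous_modulation.rpow_const fun v => .inl (modulation_pos v).ne').mul
      (F.continuous.norm.pow 2)).aestronglyMeasurable
  · have := modulation_pos v
    rw [Real.norm_of_nonneg (by positivity), sq]
    calc _ ≤ (1 + 2 * ‖v‖ ^ 2 + 2 * ‖v‖ ^ 4) * (C * ‖F v‖) := by
          gcongr
          exacts [modulation_rpow_le hb v, hF' v]
      _ = _ := by ring

lemma XNorm_nonneg (b : ℝ) (ψ : Rn 2 → ℝ → ℂ) : 0 ≤ XNorm 2 0 b ψ := by
  refine Real.rpow_nonneg (integral_nonneg fun ξ => integral_nonneg fun τ => ?_) _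
  have := japR_pos (τ - ‖ξ‖ ^ 2)
  simp only [mul_zero, Real.rpow_zero, one_mul]
  positivity

lemma ofReal_XNorm_sq {b : ℝ} (hb : b ≤ 1) (Ψ : SchwartzMap (Rn 2 × ℝ) ℂ) :
    ENNReal.ofReal (XNorm 2 0 b (fun x t => Ψ (x, t)) ^ 2) =
      ∫⁻ v, ENNReal.ofReal (modulation v ^ (2 * b)) * ‖𝓕 (toSpaceTime Ψ) v‖ₑ ^ 2 := by
  have hi := integrable_modulation_mul hb (𝓕 (toSpaceTime Ψ))
  have hpos : ∀ v, 0 ≤ modulation v ^ (2 * b) * ‖𝓕 (toSpaceTime Ψ) v‖ ^ 2 := fun v => by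
    have := modulation_pos v
    positivity
  have hX : XNorm 2 0 b (fun x t => Ψ (x, t)) =
      (∫ v, modulation v ^ (2 * b) * ‖𝓕 (toSpaceTime Ψ) v‖ ^ 2) ^ (1 / 2 : ℝ) := by
    rw [integral_spaceTime hi, XNorm]
    simp only [mul_zero, Real.rpow_zero, one_mul, stFourier_eq_fourier]
    rfl
  rw [hX, ← Real.rpow_mul_natCast (integral_nonneg hpos)]
  norm_num only [Real.rpow_one]
  rw [ofReal_integral_eq_lintegral_ofReal hi (.of_forall hpos)]
  refine lintegral_congr fun v => ?_
  rw [ENNReal.ofReal_mul (Real.rpow_nonneg (modulation_pos v).le _),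
    ENNReal.ofReal_pow (norm_nonneg _), ofReal_norm]

lemma ofReal_lpNormSTt_sq_le (δ : ℝ) (F : Rn 2 → ℝ → ℂ) :
    ENNReal.ofReal (lpNormSTt 2 2 δ F ^ 2) ≤ ∫⁻ t in Icc 0 δ, ∫⁻ x, ‖F x t‖ₑ ^ 2 := by
  have h0 : ∀ t, 0 ≤ ∫ x, ‖F x t‖ ^ (2 : ℝ) := fun t => integral_nonneg fun x => by positivity
  rw [lpNormSTt, ← Real.rpow_mul_natCast (integral_nonneg h0)]
  norm_num only [Real.rpow_one]
  rw [← Real.enorm_of_nonneg (integral_nonneg fun t => h0 t)]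
  refine (enorm_integral_le_lintegral_enorm _).trans (lintegral_mono fun t => ?_)
  refine (enorm_integral_le_lintegral_enorm _).trans (lintegral_mono fun x => ?_)
  rw [Real.rpow_ofNat, enorm_pow, enorm_norm]

lemma continuous_fourier_spaceTime {a : SpaceTime → ℂ} (ha : Integrable a) : Continuous (𝓕 a) :=
  VectorFourier.fourierIntegral_continuous (L := innerₗ SpaceTime) Real.continuous_fourierChar
    (by exact continuous_inner) ha

lemma lintegral_toLp_swap {h : SpaceTime → ENNReal} (hh : Measurable h) :
    ∫⁻ t : ℝ, ∫⁻ x : Rn 2, h (WithLp.toLp 2 (x, t)) = ∫⁻ v, h v := by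
  rw [← (WithLp.volume_preserving_toLp (Rn 2) ℝ).lintegral_comp hh]
  exact (lintegral_prod_symm _
    (hh.comp (WithLp.measurable_toLp 2 _)).aemeasurable).symm

/-- The bilinear estimate for given extensions. -/
lemma lpNormSTt_mul_le {b δ N₁ N₂ : ℝ} (hb : 1 / 2 < b) (hb' : b ≤ 1)
    (h₁ : 0 < N₁) (h₂ : 0 < N₂) {ψ₁ ψ₂ : Rn 2 → ℝ → ℂ} {Ψ₁ Ψ₂ : SchwartzMap (Rn 2 × ℝ) ℂ}
    (hs₁ : ∀ t, Function.support (𝓕 fun x => ψ₁ x t) ⊆ annulus N₁)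
    (hs₂ : ∀ t, Function.support (𝓕 fun x => ψ₂ x t) ⊆ annulus N₂)
    (he₁ : ∀ x, ∀ t ∈ Icc 0 δ, Ψ₁ (x, t) = ψ₁ x t)
    (he₂ : ∀ x, ∀ t ∈ Icc 0 δ, Ψ₂ (x, t) = ψ₂ x t) :
    lpNormSTt 2 2 δ (fun x t => ψ₁ x t * ψ₂ x t) ^ 2 ≤
      64 * Real.pi * (N₁ / N₂) * (∫⁻ y, ENNReal.ofReal (japR y ^ (-(2 * b)))).toReal ^ 2 *
        XNorm 2 0 b (fun x t => Ψ₁ (x, t)) ^ 2 * XNorm 2 0 b (fun x t => Ψ₂ (x, t)) ^ 2 := by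
  let a : ℝ → SchwartzMap (Rn 2 × ℝ) ℂ → SpaceTime → ℂ := fun N Ψ =>
    {v | v.fst ∈ annulus N}.indicator (𝓕 (toSpaceTime Ψ) : SchwartzMap SpaceTime ℂ)
  have ha : ∀ N Ψ, Integrable (a N Ψ) := fun N Ψ =>
    (SchwartzMap.integrable _).indicator measurableSet_fst_mem_annulus
  have hm : ∀ N Ψ, Measurable (a N Ψ) := fun N Ψ =>
    (SchwartzMap.continuous _).measurable.indicator measurableSet_fst_mem_annulus
  have hsupp : ∀ N Ψ, ∀ v : SpaceTime, v.fst ∉ annulus N → a N Ψ v = 0 := fun N Ψ v hv =>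
    indicator_of_notMem (s := {v : SpaceTime | v.fst ∈ annulus N}) hv _
  have hrep : ∀ {N : ℝ} {ψ : Rn 2 → ℝ → ℂ} {Ψ : SchwartzMap (Rn 2 × ℝ) ℂ},
      (∀ t, Function.support (𝓕 fun x => ψ x t) ⊆ annulus N) →
      (∀ x, ∀ t ∈ Icc 0 δ, Ψ (x, t) = ψ x t) →
      ∀ t ∈ Icc 0 δ, ∀ x, ψ x t = 𝓕 (a N Ψ) (-WithLp.toLp 2 (x, t)) := by
    intro N ψ Ψ hs he t ht x
    have hinv : ∀ y, ψ y t = 𝓕⁻ ((𝓕 (toSpaceTime Ψ) : SchwartzMap SpaceTime ℂ) : SpaceTime → ℂ)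
        (WithLp.toLp 2 (y, t)) := fun y => by
      rw [← SchwartzMap.fourierInv_coe, FourierTransform.fourierInv_fourier_eq,
        toSpaceTime_toLp, he y t ht]
    have hs' := hs t
    simp only [hinv] at hs'
    rw [← Real.fourierInv_eq_fourier_neg, hinv]
    exact fourierInv_eq_fourierInv_indicator _ hs' x
  have hE : ∀ N Ψ, ∫⁻ v, ENNReal.ofReal (modulation v ^ (2 * b)) * ‖a N Ψ v‖ₑ ^ 2 ≤
      ENNReal.ofReal (XNorm 2 0 b (fun x t => Ψ (x, t)) ^ 2) := fun N Ψ => by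
    rw [ofReal_XNorm_sq hb']
    refine lintegral_mono fun v => ?_
    gcongr
    exact enorm_indicator_le_enorm_self _ _
  let h : SpaceTime → ENNReal := fun v => ‖𝓕 (a N₁ Ψ₁) (-v) * 𝓕 (a N₂ Ψ₂) (-v)‖ₑ ^ 2
  have hh : Measurable h := by
    have := continuous_fourier_spaceTime (ha N₁ Ψ₁)
    have := continuous_fourier_spaceTime (ha N₂ Ψ₂)
    exact Continuous.measurable (by fun_prop)
  have hI := (lintegral_japR_rpow_lt_top hb).ne
  have key : ENNReal.ofReal (lpNormSTt 2 2 δ (fun x t => ψ₁ x t * ψ₂ x t) ^ 2) ≤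
      ENNReal.ofReal (64 * Real.pi * (N₁ / N₂)) *
        (∫⁻ y, ENNReal.ofReal (japR y ^ (-(2 * b)))) ^ 2 *
        ENNReal.ofReal (XNorm 2 0 b (fun x t => Ψ₁ (x, t)) ^ 2) *
        ENNReal.ofReal (XNorm 2 0 b (fun x t => Ψ₂ (x, t)) ^ 2) := calc
    _ ≤ ∫⁻ t in Icc 0 δ, ∫⁻ x, ‖ψ₁ x t * ψ₂ x t‖ₑ ^ 2 := ofReal_lpNormSTt_sq_le _ _
    _ = ∫⁻ t in Icc 0 δ, ∫⁻ x, h (WithLp.toLp 2 (x, t)) :=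
      setLIntegral_congr_fun measurableSet_Icc fun t ht => lintegral_congr fun x => by
        simp only [h]
        rw [hrep hs₁ he₁ t ht x, hrep hs₂ he₂ t ht x]
    _ ≤ ∫⁻ t, ∫⁻ x, h (WithLp.toLp 2 (x, t)) := setLIntegral_le_lintegral _ _
    _ = ∫⁻ v, ‖𝓕 (a N₁ Ψ₁) v * 𝓕 (a N₂ Ψ₂) v‖ₑ ^ 2 := by
      rw [lintegral_toLp_swap hh]
      exact lintegral_neg_eq_self fun v => ‖𝓕 (a N₁ Ψ₁) v * 𝓕 (a N₂ Ψ₂) v‖ₑ ^ 2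
    _ ≤ _ := by
      refine (lintegral_enorm_sq_fourier_mul_le (b := b) h₁ h₂ (ha _ _) (ha _ _) (hm _ _)
        (hm _ _) (hsupp _ _) (hsupp _ _)).trans ?_
      gcongr
      exacts [hE N₁ Ψ₁, hE N₂ Ψ₂]
  rw [← ENNReal.ofReal_toReal hI, ← ENNReal.ofReal_pow ENNReal.toReal_nonneg,
    ← ENNReal.ofReal_mul (by positivity), ← ENNReal.ofReal_mul (by positivity),
    ← ENNReal.ofReal_mul (by positivity)] at key
  exact (ENNReal.ofReal_le_ofReal_iff (by positivity)).1 key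

lemma le_mul_sInf {S : Set ℝ} {c L : ℝ} (hS : S.Nonempty) (hc : 0 ≤ c)
    (h : ∀ r ∈ S, L ≤ c * r) : L ≤ c * sInf S := by
  rcases hc.eq_or_lt with rfl | hc
  · obtain ⟨r, hr⟩ := hS
    simpa using h r hr
  · rw [← div_le_iff₀' hc]
    exact le_csInf hS fun r hr => (div_le_iff₀' hc).2 (h r hr)

/-- The bilinear estimate in restricted norms. -/
lemma lpNormSTt_mul_le_XRNorm {b δ N₁ N₂ : ℝ} (hb : 1 / 2 < b) (hb' : b ≤ 1)
    (h₁ : 0 < N₁) (h₂ : 0 < N₂) {ψ₁ ψ₂ : SchwartzMap (Rn 2 × ℝ) ℂ}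
    (hs₁ : ∀ t, Function.support (𝓕 fun x => ψ₁ (x, t)) ⊆ annulus N₁)
    (hs₂ : ∀ t, Function.support (𝓕 fun x => ψ₂ (x, t)) ⊆ annulus N₂) :
    lpNormSTt 2 2 δ (fun x t => ψ₁ (x, t) * ψ₂ (x, t)) ≤
      (8 * Real.sqrt Real.pi * (∫⁻ y, ENNReal.ofReal (japR y ^ (-(2 * b)))).toReal + 1) *
        (N₁ / N₂) ^ (1 / 2 : ℝ) * XRNorm 2 0 b δ (fun x t => ψ₁ (x, t)) *
        XRNorm 2 0 b δ (fun x t => ψ₂ (x, t)) := by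
  set I := (∫⁻ y, ENNReal.ofReal (japR y ^ (-(2 * b)))).toReal
  have hI : 0 ≤ I := ENNReal.toReal_nonneg
  have hXR : ∀ ψ : SchwartzMap (Rn 2 × ℝ) ℂ, 0 ≤ XRNorm 2 0 b δ (fun x t => ψ (x, t)) := fun ψ =>
    Real.sInf_nonneg (by rintro _ ⟨Ψ, -, rfl⟩; exact XNorm_nonneg _ _)
  refine le_mul_sInf ⟨_, ψ₂, fun _ _ _ => rfl, rfl⟩ ?_ ?_
  · have := hXR ψ₁
    positivity
  rintro _ ⟨Ψ₂, he₂, rfl⟩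
  rw [mul_right_comm]
  refine le_mul_sInf ⟨_, ψ₁, fun _ _ _ => rfl, rfl⟩ ?_ ?_
  · have := XNorm_nonneg b (fun x t => Ψ₂ (x, t))
    positivity
  rintro _ ⟨Ψ₁, he₁, rfl⟩
  have key := lpNormSTt_mul_le (δ := δ) hb hb' h₁ h₂ hs₁ hs₂ he₁ he₂
  have hX₁ := XNorm_nonneg b (fun x t => Ψ₁ (x, t))
  have hX₂ := XNorm_nonneg b (fun x t => Ψ₂ (x, t))
  refine (abs_le_of_sq_le_sq' ?_ (by positivity)).2
  refine key.trans ?_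
  rw [← Real.sqrt_eq_rpow]
  have hρ := Real.sq_sqrt (div_pos h₁ h₂).le
  have hπ := Real.sq_sqrt Real.pi_pos.le
  calc _ = (8 * Real.sqrt Real.pi * I * Real.sqrt (N₁ / N₂) *
        XNorm 2 0 b (fun x t => Ψ₂ (x, t)) * XNorm 2 0 b (fun x t => Ψ₁ (x, t))) ^ 2 := by
        simp only [mul_pow, hρ, hπ]
        ring
    _ ≤ _ := by
        gcongr
        linarith

/-- Bilinear refinement of the Strichartz estimate (Bourgain), in ℝ^{2+1}. -/
theorem statement_6 :
    ∃ ε₀ > (0:ℝ), ∀ ε : ℝ, 0 < ε → ε < ε₀ →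
    ∃ C > (0:ℝ), ∀ δ : ℝ, 0 < δ → δ ≤ 1 →
    ∀ k₁ k₂ : ℤ, (2:ℝ) ^ k₁ ≤ (2:ℝ) ^ k₂ →
    ∀ ψ₁ ψ₂ : SchwartzMap (Rn 2 × ℝ) ℂ,
    (∀ t : ℝ, Function.support (fun ξ => 𝓕 (fun x => ψ₁ (x, t)) ξ) ⊆
      {ξ : Rn 2 | (2:ℝ) ^ k₁ / 2 ≤ ‖ξ‖ ∧ ‖ξ‖ ≤ 2 * (2:ℝ) ^ k₁}) →
    (∀ t : ℝ, Function.support (fun ξ => 𝓕 (fun x => ψ₂ (x, t)) ξ) ⊆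
      {ξ : Rn 2 | (2:ℝ) ^ k₂ / 2 ≤ ‖ξ‖ ∧ ‖ξ‖ ≤ 2 * (2:ℝ) ^ k₂}) →
    lpNormSTt 2 2 δ (fun x t => ψ₁ (x, t) * ψ₂ (x, t))
      ≤ C * ((2:ℝ) ^ k₁ / (2:ℝ) ^ k₂) ^ (1/2 : ℝ) *
        XRNorm 2 0 (1/2 + ε) δ (fun x t => ψ₁ (x, t)) *
        XRNorm 2 0 (1/2 + ε) δ (fun x t => ψ₂ (x, t)) ∧
    lpNormSTt 2 2 δ (fun x t => (starRingEnd ℂ) (ψ₁ (x, t)) * ψ₂ (x, t))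
      ≤ C * ((2:ℝ) ^ k₁ / (2:ℝ) ^ k₂) ^ (1/2 : ℝ) *
        XRNorm 2 0 (1/2 + ε) δ (fun x t => ψ₁ (x, t)) *
        XRNorm 2 0 (1/2 + ε) δ (fun x t => ψ₂ (x, t)) ∧
    lpNormSTt 2 2 δ (fun x t => ψ₁ (x, t) * (starRingEnd ℂ) (ψ₂ (x, t)))
      ≤ C * ((2:ℝ) ^ k₁ / (2:ℝ) ^ k₂) ^ (1/2 : ℝ) *
        XRNorm 2 0 (1/2 + ε) δ (fun x t => ψ₁ (x, t)) *
        XRNorm 2 0 (1/2 + ε) δ (fun x t => ψ₂ (x, t)) := by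
  refine ⟨1 / 2, by norm_num, fun ε hε hε' => ⟨8 * Real.sqrt Real.pi *
    (∫⁻ y, ENNReal.ofReal (japR y ^ (-(2 * (1 / 2 + ε))))).toReal + 1, by positivity, ?_⟩⟩
  intro δ _ _ k₁ k₂ _ ψ₁ ψ₂ hs₁ hs₂
  have h := lpNormSTt_mul_le_XRNorm (δ := δ) (b := 1 / 2 + ε) (by linarith) (by linarith)
    (by positivity) (by positivity) hs₁ hs₂
  refine ⟨h, (le_of_eq ?_).trans h, (le_of_eq ?_).trans h⟩ <;> simp [lpNormSTt]

end
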